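/- Let φ : B → C be a C*-algebra homomorphism between C*-algebras carrying circle actions γ (on B) and β (on C) satisfying β_z ∘ φ = φ ∘ γ_z for all z ∈ S¹, where γ is a continuous action. If the restriction of φ to the fixed-point algebra of γ is injective and γ admits a faithful conditional expectation onto its fixed-point algebra given by averaging, then φ is injective on all of B. -/

import Mathlib

noncomputable section

variable {B C : Type*}
  [NormedRing B] [StarRing B] [CStarRing B] [NormedAlgebra ℂ B] [CompleteSpace B]
  [StarModule ℂ B]
  [NormedRing C] [StarRing C] [CStarRing C] [NormedAlgebra ℂ C] [CompleteSpace C]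
  [StarModule ℂ C]

/-- The averaging map `E_γ(x) = ∫_{S¹} γ_z(x) dz` (normalized Haar measure on the circle,
parametrized by `z = e^{2πit}`, `t ∈ [0,1]`). -/
def gaugeAvg (γ : Circle → (B ≃⋆ₐ[ℂ] B)) (x : B) : B :=
  ∫ t in (0 : ℝ)..1, γ (Circle.exp (2 * Real.pi * t)) x

/-- Let `φ : B → C` be a `*`-homomorphism between C*-algebras carrying circle
actions `γ` (on `B`, point-norm continuous) and `β` (on `C`) with `β_z ∘ φ = φ ∘ γ_z`.  If the
averaging map `E_γ` is a faithful conditional expectation onto the fixed-point algebra of `γ`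
and `φ` is injective on that fixed-point algebra, then `φ` is injective on all of `B`. -/
theorem stmt14 (φ : B →⋆ₐ[ℂ] C) (hφc : Continuous φ)
    (γ : Circle → (B ≃⋆ₐ[ℂ] B)) (β : Circle → (C ≃⋆ₐ[ℂ] C))
    (hγ_mul : ∀ (z w : Circle) (x : B), γ (z * w) x = γ z (γ w x))
    (hγ_cont : ∀ x : B, Continuous fun z : Circle => γ z x)
    (hβ_mul : ∀ (z w : Circle) (x : C), β (z * w) x = β z (β w x))
    (hintertwine : ∀ (z : Circle) (x : B), φ (γ z x) = β z (φ x))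
    -- `E_γ` maps into the fixed-point algebra of `γ` …
    (hEfix : ∀ (x : B) (z : Circle), γ z (gaugeAvg γ x) = gaugeAvg γ x)
    -- … and is faithful:
    (hEfaithful : ∀ x : B, gaugeAvg γ (star x * x) = 0 → x = 0)
    -- `φ` is injective on the fixed-point algebra of `γ`:
    (hinj : ∀ x : B, (∀ z : Circle, γ z x = x) → φ x = 0 → x = 0) :
    Function.Injective φ := by
  rw [injective_iff_map_eq_zero]
  intro x hx
  refine hEfaithful x (hinj _ (hEfix _) ?_)
  let L : B →L[ℂ] C := ⟨φ.toAlgHom.toLinearMap, hφc⟩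
  have hexp : Continuous fun t : ℝ => Circle.exp (2 * Real.pi * t) :=
    Circle.exp.continuous.comp (continuous_const.mul continuous_id)
  have hint : IntervalIntegrable
      (fun t : ℝ => γ (Circle.exp (2 * Real.pi * t)) (star x * x)) MeasureTheory.volume 0 1 :=
    ((hγ_cont (star x * x)).comp hexp).intervalIntegrable 0 1
  have hpt (t : ℝ) : L (γ (Circle.exp (2 * Real.pi * t)) (star x * x)) = 0 := by
    change φ _ = 0
    rw [hintertwine, map_mul φ, hx, mul_zero, map_zero]
  change L (gaugeAvg γ (star x * x)) = 0
  unfold gaugeAvg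
  rw [← L.intervalIntegral_comp_comm hint]
  simp only [hpt, intervalIntegral.integral_zero]

end
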